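/- arXiv:1905.00034 — 2 statements merged into one kernel-verified Lean document; each statement's English description precedes it below -/
import Mathlib

section
/- Let χ > 0 and let β : ℝ² → ℝ² be the linear map with β(1,0) = −(1+χ)·(1,0) and β(0,1) = (1−χ)·(0,1) (the boost action on the two-dimensional exotic spacetime S19_χ, with H = (1,0), P = (0,1)). If χ ≠ 1 and χ ≠ 3, then the only bilinear map α : ℝ² × ℝ² → ℝ² that is β-equivariant is α = 0. If χ = 3, then the β-equivariant bilinear maps are exactly those of the form α((h,p),(h',p')) = (ζ p p', 0) for some ζ ∈ ℝ, i.e. α(P,P) = ζ H with all other components zero. -/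
/-- A bilinear map `α : V × V → V` is equivariant under a linear endomorphism `β` of `V`
if `β (α Y Z) = α (β Y) Z + α Y (β Z)` for all `Y Z ∈ V`. -/
def IsEquivariant (β : ℝ × ℝ →ₗ[ℝ] ℝ × ℝ)
    (α : ℝ × ℝ →ₗ[ℝ] ℝ × ℝ →ₗ[ℝ] ℝ × ℝ) : Prop :=
  ∀ Y Z : ℝ × ℝ, β (α Y Z) = α (β Y) Z + α Y (β Z)

/-- The boost action `λ_B` on the exotic two-dimensional spacetime `S19_χ`:
`β H = -(1+χ) H` and `β P = (1-χ) P`, with `H = (1,0)` and `P = (0,1)`. -/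
noncomputable def boostS19 (χ : ℝ) : ℝ × ℝ →ₗ[ℝ] ℝ × ℝ :=
  LinearMap.prod ((-(1 + χ)) • LinearMap.fst ℝ ℝ ℝ) ((1 - χ) • LinearMap.snd ℝ ℝ ℝ)

@[simp]
theorem boostS19_apply (χ : ℝ) (v : ℝ × ℝ) :
    boostS19 χ v = (-(1 + χ) * v.1, (1 - χ) * v.2) := rfl

theorem IsEquivariant.apply_eigenvectors {β : ℝ × ℝ →ₗ[ℝ] ℝ × ℝ}
    {α : ℝ × ℝ →ₗ[ℝ] ℝ × ℝ →ₗ[ℝ] ℝ × ℝ} (h : IsEquivariant β α) {a b : ℝ} {u v : ℝ × ℝ}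
    (hu : β u = a • u) (hv : β v = b • v) : β (α u v) = (a + b) • α u v := by
  rw [h, hu, hv, map_smul, map_smul, LinearMap.smul_apply, add_smul]

theorem fst_eq_zero_of_boostS19_eq_smul {χ c : ℝ} {x : ℝ × ℝ} (h : boostS19 χ x = c • x)
    (hc : c ≠ -(1 + χ)) : x.1 = 0 := by
  have h₁ : -(1 + χ) * x.1 = c * x.1 := congrArg Prod.fst h
  by_contra hx
  exact hc (mul_right_cancel₀ hx h₁).symm

theorem snd_eq_zero_of_boostS19_eq_smul {χ c : ℝ} {x : ℝ × ℝ} (h : boostS19 χ x = c • x)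
    (hc : c ≠ 1 - χ) : x.2 = 0 := by
  have h₂ : (1 - χ) * x.2 = c * x.2 := congrArg Prod.snd h
  by_contra hx
  exact hc (mul_right_cancel₀ hx h₂).symm

theorem bilinear_apply_prod (α : ℝ × ℝ →ₗ[ℝ] ℝ × ℝ →ₗ[ℝ] ℝ × ℝ) (v w : ℝ × ℝ) :
    α v w = (v.1 * w.1) • α (1, 0) (1, 0) + (v.1 * w.2) • α (1, 0) (0, 1) +
      (v.2 * w.1) • α (0, 1) (1, 0) + (v.2 * w.2) • α (0, 1) (0, 1) := by
  have decomp (x : ℝ × ℝ) : x = x.1 • ((1, 0) : ℝ × ℝ) + x.2 • ((0, 1) : ℝ × ℝ) := by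
    ext <;> simp
  conv_lhs => rw [decomp v, decomp w]
  simp only [map_add, map_smul, LinearMap.add_apply, LinearMap.smul_apply]
  module

/-- Away from `χ = 1`, only the `H`-component of `α(P,P)` can be nonzero. -/
theorem IsEquivariant.apply_eq_of_boostS19 {χ : ℝ} (hχ : 0 < χ) (hχ₁ : χ ≠ 1)
    {α : ℝ × ℝ →ₗ[ℝ] ℝ × ℝ →ₗ[ℝ] ℝ × ℝ} (h : IsEquivariant (boostS19 χ) α) (v w : ℝ × ℝ) :
    α v w = ((α (0, 1) (0, 1)).1 * (v.2 * w.2), 0) := by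
  have hH : boostS19 χ (1, 0) = (-(1 + χ)) • ((1, 0) : ℝ × ℝ) := by ext <;> simp
  have hP : boostS19 χ (0, 1) = (1 - χ) • ((0, 1) : ℝ × ℝ) := by ext <;> simp
  have hb : 1 - χ ≠ 0 := sub_ne_zero.2 hχ₁.symm
  have hHH : α (1, 0) (1, 0) = 0 := Prod.ext
    (fst_eq_zero_of_boostS19_eq_smul (h.apply_eigenvectors hH hH) (by intro; linarith))
    (snd_eq_zero_of_boostS19_eq_smul (h.apply_eigenvectors hH hH) (by intro; linarith))
  have hHP : α (1, 0) (0, 1) = 0 := Prod.ext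
    (fst_eq_zero_of_boostS19_eq_smul (h.apply_eigenvectors hH hP)
      (fun e => hb (by linarith)))
    (snd_eq_zero_of_boostS19_eq_smul (h.apply_eigenvectors hH hP) (by intro; linarith))
  have hPH : α (0, 1) (1, 0) = 0 := Prod.ext
    (fst_eq_zero_of_boostS19_eq_smul (h.apply_eigenvectors hP hH)
      (fun e => hb (by linarith)))
    (snd_eq_zero_of_boostS19_eq_smul (h.apply_eigenvectors hP hH) (by intro; linarith))
  have hPP : (α (0, 1) (0, 1)).2 = 0 :=
    snd_eq_zero_of_boostS19_eq_smul (h.apply_eigenvectors hP hP) (fun e => hb (by linarith))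
  rw [bilinear_apply_prod α v w, hHH, hHP, hPH]
  ext <;> simp [hPP, mul_comm]

/-- For the exotic spacetime `S19_χ` with `χ > 0`: if `χ ≠ 1` and `χ ≠ 3`, the only
boost-equivariant bilinear map (Nomizu map) on `ℝ²` is zero, while for `χ = 3` the
boost-equivariant bilinear maps are exactly `α((h,p),(h',p')) = (ζ p p', 0)` for
`ζ ∈ ℝ`, i.e. `α(P,P) = ζ H` with all other components zero. -/
theorem S19_invariant_nomizu_maps (χ : ℝ) (hχ : 0 < χ) :
    (χ ≠ 1 → χ ≠ 3 →
      ∀ α : ℝ × ℝ →ₗ[ℝ] ℝ × ℝ →ₗ[ℝ] ℝ × ℝ, IsEquivariant (boostS19 χ) α → α = 0) ∧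
    (χ = 3 → ∀ α : ℝ × ℝ →ₗ[ℝ] ℝ × ℝ →ₗ[ℝ] ℝ × ℝ,
      IsEquivariant (boostS19 χ) α ↔
        ∃ ζ : ℝ, ∀ v w : ℝ × ℝ, α v w = ((ζ * (v.2 * w.2), 0) : ℝ × ℝ)) := by
  refine ⟨fun hχ₁ hχ₃ α h => ?_, ?_⟩
  · have hP : boostS19 χ (0, 1) = (1 - χ) • ((0, 1) : ℝ × ℝ) := by ext <;> simp
    have hPP : (α (0, 1) (0, 1)).1 = 0 :=
      fst_eq_zero_of_boostS19_eq_smul (h.apply_eigenvectors hP hP)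
        (fun e => hχ₃ (by linarith))
    refine LinearMap.ext₂ fun v w => ?_
    rw [h.apply_eq_of_boostS19 hχ hχ₁, hPP, zero_mul]
    rfl
  · rintro rfl α
    refine ⟨fun h => ⟨_, h.apply_eq_of_boostS19 hχ (by norm_num)⟩, ?_⟩
    rintro ⟨ζ, hζ⟩ v w
    simp only [hζ, boostS19_apply]
    ext
    · simp only [Prod.fst_add]
      ring
    · simp
end

section
/- Let χ > 0 and let β : ℝ² → ℝ² be the linear map β(h,p) = (−(1+χ²)p, h − 2χ p) (the boost action on the two-dimensional exotic spacetime S20_χ, with H = (1,0), P = (0,1), determined by λ_B H = P and λ_B P = −(1+χ²)H − 2χ P). Then the only bilinear map α : ℝ² × ℝ² → ℝ² that is β-equivariant is α = 0; that is, the only invariant affine connection on S20_χ is the canonical one. -/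
/-- The boost action `λ_B` on the exotic two-dimensional spacetime `S20_χ`:
`β (h, p) = (-(1+χ²) p, h - 2χ p)`, i.e. `λ_B H = P` and `λ_B P = -(1+χ²)H - 2χ P`,
with `H = (1,0)` and `P = (0,1)`. -/
noncomputable def boostS20 (χ : ℝ) : ℝ × ℝ →ₗ[ℝ] ℝ × ℝ :=
  LinearMap.prod ((-(1 + χ ^ 2)) • LinearMap.snd ℝ ℝ ℝ)
    (LinearMap.fst ℝ ℝ ℝ - (2 * χ) • LinearMap.snd ℝ ℝ ℝ)

/-- The linear system expressing, in an orthonormal basis, equivariance of a bilinear map on the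
plane under `-χ + J`, with `J` the rotation by a right angle, has only the zero solution. -/
theorem eq_zero_of_rotation_system {χ : ℝ} (hχ : 0 < χ) {a₁ a₂ b₁ b₂ c₁ c₂ d₁ d₂ : ℝ}
    (ha₁ : χ * a₁ - a₂ = b₁ + c₁) (ha₂ : χ * a₂ + a₁ = b₂ + c₂)
    (hb₁ : χ * b₁ - b₂ = d₁ - a₁) (hb₂ : χ * b₂ + b₁ = d₂ - a₂)
    (hc₁ : χ * c₁ - c₂ = d₁ - a₁) (hc₂ : χ * c₂ + c₁ = d₂ - a₂)
    (hd₁ : χ * d₁ - d₂ = -b₁ - c₁) (hd₂ : χ * d₂ + d₁ = -b₂ - c₂) :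
    (a₁ = 0 ∧ a₂ = 0) ∧ (b₁ = 0 ∧ b₂ = 0) ∧ (c₁ = 0 ∧ c₂ = 0) ∧ (d₁ = 0 ∧ d₂ = 0) := by
  have h : χ * (a₁ ^ 2 + a₂ ^ 2 + b₁ ^ 2 + b₂ ^ 2 + c₁ ^ 2 + c₂ ^ 2 + d₁ ^ 2 + d₂ ^ 2) = 0 := by
    linear_combination a₁ * ha₁ + a₂ * ha₂ + b₁ * hb₁ + b₂ * hb₂ + c₁ * hc₁ + c₂ * hc₂ +
      d₁ * hd₁ + d₂ * hd₂
  have hs := (mul_eq_zero.mp h).resolve_left hχ.ne'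
  refine ⟨⟨?_, ?_⟩, ⟨?_, ?_⟩, ⟨?_, ?_⟩, ?_, ?_⟩ <;>
    refine (pow_eq_zero_iff two_ne_zero).mp ?_ <;>
    linarith [sq_nonneg a₁, sq_nonneg a₂, sq_nonneg b₁, sq_nonneg b₂,
      sq_nonneg c₁, sq_nonneg c₂, sq_nonneg d₁, sq_nonneg d₂]

theorem boostS20_apply (χ : ℝ) (v : ℝ × ℝ) :
    boostS20 χ v = (-(1 + χ ^ 2) * v.2, v.1 - 2 * χ * v.2) := by
  simp [boostS20]

/-- In the basis `e₁ = H`, `e₂ = P + χ H`, the boost acts by `-χ` plus a rotation. -/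
theorem boostS20_fst_basis (χ : ℝ) : boostS20 χ (1, 0) = -χ • (1, 0) + (χ, 1) := by
  simp [boostS20_apply]

theorem boostS20_snd_basis (χ : ℝ) : boostS20 χ (χ, 1) = -χ • (χ, 1) - (1, 0) := by
  rw [boostS20_apply]
  ext <;> simp <;> ring

/-- For the exotic spacetime `S20_χ` with `χ > 0`, the only boost-equivariant bilinear
map (Nomizu map) on `ℝ²` is zero: the only invariant affine connection on `S20_χ` is
the canonical one. -/
theorem S20_invariant_nomizu_map_eq_zero (χ : ℝ) (hχ : 0 < χ)
    (α : ℝ × ℝ →ₗ[ℝ] ℝ × ℝ →ₗ[ℝ] ℝ × ℝ)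
    (hα : IsEquivariant (boostS20 χ) α) :
    α = 0 := by
  have h₁₁ := hα (1, 0) (1, 0)
  have h₁₂ := hα (1, 0) (χ, 1)
  have h₂₁ := hα (χ, 1) (1, 0)
  have h₂₂ := hα (χ, 1) (χ, 1)
  rw [boostS20_fst_basis] at h₁₁ h₁₂ h₂₁
  rw [boostS20_snd_basis] at h₁₂ h₂₁ h₂₂
  simp only [map_add, map_sub, map_smul, LinearMap.add_apply, LinearMap.sub_apply,
    LinearMap.smul_apply, boostS20_apply] at h₁₁ h₁₂ h₂₁ h₂₂
  generalize hA : α (1, 0) (1, 0) = A at *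
  generalize hB : α (1, 0) (χ, 1) = B at *
  generalize hC : α (χ, 1) (1, 0) = C at *
  generalize hD : α (χ, 1) (χ, 1) = D at *
  obtain ⟨a₁, a₂⟩ := A
  obtain ⟨b₁, b₂⟩ := B
  obtain ⟨c₁, c₂⟩ := C
  obtain ⟨d₁, d₂⟩ := D
  simp only [Prod.smul_mk, Prod.mk_add_mk, Prod.mk_sub_mk, Prod.mk.injEq, smul_eq_mul]
    at h₁₁ h₁₂ h₂₁ h₂₂
  -- A vector `(x, y)` has coordinates `(x - χ y, y)` in the basis `e₁, e₂`.
  obtain ⟨⟨ha₁, ha₂⟩, ⟨hb₁, hb₂⟩, ⟨hc₁, hc₂⟩, hd₁, hd₂⟩ :=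
    eq_zero_of_rotation_system hχ (a₁ := a₁ - χ * a₂) (a₂ := a₂) (b₁ := b₁ - χ * b₂) (b₂ := b₂)
      (c₁ := c₁ - χ * c₂) (c₂ := c₂) (d₁ := d₁ - χ * d₂) (d₂ := d₂)
      (by linear_combination h₁₁.1 - χ * h₁₁.2) (by linear_combination h₁₁.2)
      (by linear_combination h₁₂.1 - χ * h₁₂.2) (by linear_combination h₁₂.2)
      (by linear_combination h₂₁.1 - χ * h₂₁.2) (by linear_combination h₂₁.2)
      (by linear_combination h₂₂.1 - χ * h₂₂.2) (by linear_combination h₂₂.2)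
  subst ha₂ hb₂ hc₂ hd₂
  simp only [mul_zero, sub_zero] at ha₁ hb₁ hc₁ hd₁
  subst ha₁ hb₁ hc₁ hd₁
  have hdecomp (v : ℝ × ℝ) : v = (v.1 - χ * v.2) • (1, 0) + v.2 • (χ, 1) := by
    ext <;> simp [mul_comm]
  refine LinearMap.ext₂ fun Y Z => ?_
  rw [hdecomp Y, hdecomp Z]
  simp only [map_add, map_smul, LinearMap.add_apply, LinearMap.smul_apply, hA, hB, hC, hD]
  simp
end
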